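/- For every sequence (ω_m)_{m≥1} of positive reals there exists an isometric embedding F : [0,1] → L¹[0,1] which is nowhere differentiable, but such that for each t ∈ [0,1] the representative F_t is C^∞ on [0,1] with sup_{x∈[0,1]} |F_t^{(m)}(x)| ≤ ω_m for all m ≥ 1. -/

import Mathlib

open MeasureTheory Set

noncomputable abbrev mu01 : Measure ℝ := volume.restrict (Icc (0:ℝ) 1)

def HasDerivAtWithin01 {E : Type*} [NormedAddCommGroup E] [NormedSpace ℝ E]
    (F : ℝ → E) (D : E) (t₀ : ℝ) : Prop :=
  ∀ ε > (0:ℝ), ∃ δ > (0:ℝ), ∀ h : ℝ, t₀ + h ∈ Icc (0:ℝ) 1 → |h| < δ →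
    ‖F (t₀ + h) - F t₀ - h • D‖ ≤ ε * |h|

open Polynomial

/-- The polynomial distribution functions obtained from `X` by `n` steps, each applying
`u ↦ u²` or `u ↦ 2u - u²`. -/
def cdfSet : ℕ → Set ℝ[X]
  | 0 => {X}
  | n + 1 => (fun P => P ^ 2) '' cdfSet n ∪ (fun P => 2 * P - P ^ 2) '' cdfSet n

lemma cdfSet_finite (n : ℕ) : (cdfSet n).Finite := by
  induction n with
  | zero => exact Set.finite_singleton _
  | succ n ih => exact (ih.image _).union (ih.image _)

/-- `P` restricts to a distribution function on `[0,1]`. -/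
structure IsCdf (P : ℝ[X]) : Prop where
  eval_zero : P.eval 0 = 0
  eval_one : P.eval 1 = 1
  mem_Icc : ∀ x ∈ Icc (0:ℝ) 1, P.eval x ∈ Icc (0:ℝ) 1
  derivative_nonneg : ∀ x ∈ Icc (0:ℝ) 1, 0 ≤ (derivative P).eval x

lemma IsCdf.of_mem_cdfSet {n : ℕ} {P : ℝ[X]} (hP : P ∈ cdfSet n) : IsCdf P := by
  induction n generalizing P with
  | zero =>
    obtain rfl : P = X := hP
    exact ⟨by simp, by simp, by simp, by simp⟩
  | succ n ih =>
    rcases hP with ⟨R, hR, rfl⟩ | ⟨R, hR, rfl⟩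
    · obtain ⟨h0, h1, h2, h3⟩ := ih hR
      refine ⟨by simp [h0], by simp [h1], fun x hx => ?_, fun x hx => ?_⟩
      · obtain ⟨hl, hr⟩ := h2 x hx
        rw [eval_pow]
        exact ⟨by positivity, pow_le_one₀ hl hr⟩
      · have := h2 x hx
        have h3 := h3 x hx
        simp [pow_two, derivative_mul]
        have := mul_nonneg h3 this.1
        linarith
    · obtain ⟨h0, h1, h2, h3⟩ := ih hR
      refine ⟨by simp [h0], by simp [h1]; norm_num, fun x hx => ?_, fun x hx => ?_⟩
      · obtain ⟨hl, hr⟩ := h2 x hx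
        simp only [eval_sub, eval_mul, eval_ofNat, eval_pow]
        constructor <;> nlinarith
      · have := h2 x hx
        have h3 := h3 x hx
        simp [pow_two, derivative_mul]
        have := mul_nonneg h3 (sub_nonneg.2 this.2)
        linarith

/-- The amount by which the density of `P` changes under `P ↦ P²` (and minus that under
`P ↦ 2P - P²`). -/
noncomputable def bump (P : ℝ[X]) : ℝ[X] := derivative (P ^ 2 - P)

lemma eval_bump (P : ℝ[X]) (x : ℝ) :
    (bump P).eval x = (derivative P).eval x * (2 * P.eval x - 1) := by
  simp [bump, pow_two, derivative_mul]
  ring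

lemma integral_mu01_derivative (P : ℝ[X]) :
    ∫ x, (derivative P).eval x ∂mu01 = P.eval 1 - P.eval 0 := by
  rw [integral_Icc_eq_integral_Ioc, ← intervalIntegral.integral_of_le zero_le_one]
  exact intervalIntegral.integral_eq_sub_of_hasDerivAt (fun x _ => P.hasDerivAt x)
    ((derivative P).continuous.intervalIntegrable _ _)

lemma integral_bump {P : ℝ[X]} (hP : IsCdf P) : ∫ x, (bump P).eval x ∂mu01 = 0 := by
  rw [bump, integral_mu01_derivative]
  simp [hP.eval_zero, hP.eval_one]

lemma ContinuousOn.integrable_mu01 {f : ℝ → ℝ} (hf : ContinuousOn f (Icc 0 1)) :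
    Integrable f mu01 := hf.integrableOn_Icc

lemma integral_abs_bump_ge {P : ℝ[X]} (hP : IsCdf P) :
    1 / 3 ≤ ∫ x, |(bump P).eval x| ∂mu01 := by
  have key : ∫ x, (derivative (C (1 / 6) * (2 * P - 1) ^ 3)).eval x ∂mu01 = 1 / 3 := by
    rw [integral_mu01_derivative]
    simp [hP.eval_zero, hP.eval_one]
    norm_num
  rw [← key]
  refine setIntegral_mono_on ((Polynomial.continuous _).continuousOn.integrable_mu01)
    ((Polynomial.continuous _).abs.continuousOn.integrable_mu01) measurableSet_Icc
    fun x hx => ?_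
  have h2 := hP.mem_Icc x hx
  have h3 := hP.derivative_nonneg x hx
  have e : (derivative (C (1 / 6) * (2 * P - 1) ^ 3)).eval x
      = (derivative P).eval x * (2 * P.eval x - 1) ^ 2 := by
    simp [derivative_pow]
    ring
  rw [e, eval_bump, abs_mul, abs_of_nonneg h3, ← sq_abs]
  have h1 : |2 * P.eval x - 1| ≤ 1 := abs_le.2 ⟨by linarith [h2.1], by linarith [h2.2]⟩
  gcongr
  nlinarith [abs_nonneg (2 * P.eval x - 1)]

lemma exists_bound_iterate_derivative (q : ℝ[X]) {w : ℕ → ℝ} (hw : ∀ m, 0 < w m) :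
    ∃ K : ℝ, ∀ m, ∀ x ∈ Ioo (-1:ℝ) 2, |(derivative^[m] q).eval x| ≤ K * w m := by
  have h : ∀ m, ∃ K : ℝ, 0 ≤ K ∧
      ∀ x ∈ Ioo (-1:ℝ) 2, |(derivative^[m] q).eval x| ≤ K * w m := fun m => by
    obtain ⟨K, hK⟩ := (isCompact_Icc (a := (-1:ℝ)) (b := 2)).exists_bound_of_continuousOn
      (derivative^[m] q).continuous.continuousOn
    refine ⟨|K| / w m, div_nonneg (abs_nonneg _) (hw m).le, fun x hx => ?_⟩
    rw [div_mul_cancel₀ _ (hw m).ne']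
    exact (hK x (Ioo_subset_Icc_self hx)).trans (le_abs_self K)
  choose K hK0 hK using h
  refine ⟨∑ m ∈ Finset.range (q.natDegree + 1), K m, fun m x hx => ?_⟩
  by_cases hm : m ≤ q.natDegree
  · refine (hK m x hx).trans (mul_le_mul_of_nonneg_right ?_ (hw m).le)
    exact Finset.single_le_sum (fun i _ => hK0 i) (Finset.mem_range.2 (by lia))
  · rw [iterate_derivative_eq_zero (by lia)]
    simpa using mul_nonneg (Finset.sum_nonneg fun i _ => hK0 i) (hw m).le

lemma exists_bound_cdfSet {w : ℕ → ℝ} (hw : ∀ m, 0 < w m) (n : ℕ) :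
    ∃ c : ℕ, 0 < c ∧ ∀ P ∈ cdfSet n, ∀ m, ∀ x ∈ Ioo (-1:ℝ) 2,
      |(derivative^[m] (bump P)).eval x| ≤ c * ((1 / 2 / 2 ^ n) * w m) := by
  have h : ∀ᶠ c : ℕ in Filter.atTop, ∀ P ∈ cdfSet n, ∀ m, ∀ x ∈ Ioo (-1:ℝ) 2,
      |(derivative^[m] (bump P)).eval x| ≤ c * ((1 / 2 / 2 ^ n) * w m) := by
    refine (cdfSet_finite n).eventually_all.2 fun P _ => ?_
    obtain ⟨K, hK⟩ := exists_bound_iterate_derivative (bump P)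
      (w := fun m => 1 / 2 / 2 ^ n * w m) (fun m => mul_pos (by positivity) (hw m))
    obtain ⟨k, hk⟩ := exists_nat_ge K
    filter_upwards [Filter.eventually_ge_atTop k] with c hc m x hx
    refine (hK m x hx).trans (mul_le_mul_of_nonneg_right ?_ ?_)
    · exact hk.trans (by exact_mod_cast hc)
    · exact (mul_pos (by positivity) (hw m)).le
  obtain ⟨c, hc, hc0⟩ := (h.and (Filter.eventually_gt_atTop 0)).exists
  exact ⟨c, hc0, hc⟩

section SmoothSeries

lemma Icc_zero_one_subset_Ioo : Icc (0:ℝ) 1 ⊆ Ioo (-1) 2 :=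
  Icc_subset_Ioo (by norm_num) (by norm_num)

variable {q : ℕ → ℝ[X]} {w : ℕ → ℝ}

lemma hasSum_half_geometric_mul (a : ℝ) : HasSum (fun n : ℕ => 1 / 2 / 2 ^ n * a) a := by
  simpa using (hasSum_geometric_two' 1).mul_right a

lemma summable_iterate_derivative
    (hq : ∀ n m, ∀ x ∈ Ioo (-1:ℝ) 2, |(derivative^[m] (q n)).eval x| ≤ 1 / 2 / 2 ^ n * w m)
    (m : ℕ) {x : ℝ} (hx : x ∈ Ioo (-1:ℝ) 2) :
    Summable fun n => (derivative^[m] (q n)).eval x :=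
  .of_norm_bounded (hasSum_half_geometric_mul (w m)).summable fun n => hq n m x hx

lemma hasDerivAt_tsum_iterate_derivative
    (hq : ∀ n m, ∀ x ∈ Ioo (-1:ℝ) 2, |(derivative^[m] (q n)).eval x| ≤ 1 / 2 / 2 ^ n * w m)
    (m : ℕ) {x : ℝ} (hx : x ∈ Ioo (-1:ℝ) 2) :
    HasDerivAt (fun y => ∑' n, (derivative^[m] (q n)).eval y)
      (∑' n, (derivative^[m + 1] (q n)).eval x) x := by
  refine hasDerivAt_tsum_of_isPreconnected (g := fun n y => (derivative^[m] (q n)).eval y)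
    (g' := fun n y => (derivative^[m + 1] (q n)).eval y)
    (hasSum_half_geometric_mul (w (m + 1))).summable
    isOpen_Ioo isPreconnected_Ioo (fun n y _ => ?_) (fun n y hy => hq n (m + 1) y hy) hx
    (summable_iterate_derivative hq m hx) hx
  rw [Function.iterate_succ_apply']
  exact Polynomial.hasDerivAt _ _

lemma iteratedDerivWithin_const_add_tsum_eval
    (hq : ∀ n m, ∀ x ∈ Ioo (-1:ℝ) 2, |(derivative^[m] (q n)).eval x| ≤ 1 / 2 / 2 ^ n * w m)
    (a : ℝ) (m : ℕ) {x : ℝ} (hx : x ∈ Icc (0:ℝ) 1) :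
    iteratedDerivWithin m (fun y => a + ∑' n, (q n).eval y) (Icc 0 1) x
      = (if m = 0 then a else 0) + ∑' n, (derivative^[m] (q n)).eval x := by
  induction m generalizing x with
  | zero => simp
  | succ m ih =>
    have hx' := Icc_zero_one_subset_Ioo hx
    rw [iteratedDerivWithin_succ, derivWithin_congr (fun y hy => ih hy) (ih hx)]
    simpa using ((hasDerivAt_tsum_iterate_derivative hq m hx').const_add
      (if m = 0 then a else 0)).hasDerivWithinAt.derivWithin (uniqueDiffOn_Icc one_pos x hx)

lemma contDiffOn_const_add_tsum_eval
    (hq : ∀ n m, ∀ x ∈ Ioo (-1:ℝ) 2, |(derivative^[m] (q n)).eval x| ≤ 1 / 2 / 2 ^ n * w m)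
    (a : ℝ) :
    ContDiffOn ℝ (⊤ : ℕ∞) (fun y => a + ∑' n, (q n).eval y) (Icc 0 1) := by
  refine contDiffOn_of_differentiableOn_deriv fun m _ x hx => ?_
  have hx' := Icc_zero_one_subset_Ioo hx
  exact ((hasDerivAt_tsum_iterate_derivative hq m hx').const_add
    (if m = 0 then a else 0)).differentiableAt.differentiableWithinAt.congr
    (fun y hy => iteratedDerivWithin_const_add_tsum_eval hq a m hy)
    (iteratedDerivWithin_const_add_tsum_eval hq a m hx)

lemma abs_iteratedDerivWithin_const_add_tsum_eval_le
    (hq : ∀ n m, ∀ x ∈ Ioo (-1:ℝ) 2, |(derivative^[m] (q n)).eval x| ≤ 1 / 2 / 2 ^ n * w m)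
    (a : ℝ) {m : ℕ} (hm : m ≠ 0) {x : ℝ} (hx : x ∈ Icc (0:ℝ) 1) :
    |iteratedDerivWithin m (fun y => a + ∑' n, (q n).eval y) (Icc 0 1) x| ≤ w m := by
  rw [iteratedDerivWithin_const_add_tsum_eval hq a m hx, if_neg hm, zero_add]
  exact tsum_of_norm_bounded (f := fun n => (derivative^[m] (q n)).eval x)
    (hasSum_half_geometric_mul (w m)) fun n => hq n m x (Icc_zero_one_subset_Ioo hx)

end SmoothSeries

section Construction

/-- The number of cells per unit length on which the `n`-th approximation is affine. -/
def cells (c : ℕ → ℕ) : ℕ → ℕ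
  | 0 => 1
  | n + 1 => 2 * (c n * cells c n)

/-- The number of periods per unit length of the `n`-th oscillation. -/
def periods (c : ℕ → ℕ) (n : ℕ) : ℕ := c n * cells c n

/-- The triangular wave of slope `±1` with `periods c n` periods per unit length. -/
noncomputable def tent (c : ℕ → ℕ) (n : ℕ) (t : ℝ) : ℝ :=
  min (Int.fract (periods c n * t)) (1 - Int.fract (periods c n * t)) / periods c n

/-- The distribution function in `x` of the slope of the `n`-th approximation at time `t`. -/
noncomputable def slopeCdf (c : ℕ → ℕ) : ℕ → ℝ → ℝ[X]
  | 0, _ => X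
  | n + 1, t => if Int.fract (periods c n * t) < 1 / 2 then slopeCdf c n t ^ 2
      else 2 * slopeCdf c n t - slopeCdf c n t ^ 2

/-- The `n`-th approximation of the curve. -/
noncomputable def approx (c : ℕ → ℕ) (n : ℕ) (t x : ℝ) : ℝ :=
  t + ∑ k ∈ Finset.range n, tent c k t * (bump (slopeCdf c k t)).eval x

/-- The limiting curve. -/
noncomputable def curve (c : ℕ → ℕ) (t x : ℝ) : ℝ :=
  t + ∑' k, (C (tent c k t) * bump (slopeCdf c k t)).eval x

variable {c : ℕ → ℕ}

lemma slopeCdf_mem (c : ℕ → ℕ) (n : ℕ) (t : ℝ) : slopeCdf c n t ∈ cdfSet n := by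
  induction n with
  | zero => rfl
  | succ n ih =>
    rw [slopeCdf]
    split_ifs
    · exact Or.inl ⟨_, ih, rfl⟩
    · exact Or.inr ⟨_, ih, rfl⟩

lemma cells_pos (hc : ∀ n, 0 < c n) (n : ℕ) : 0 < cells c n := by
  induction n with
  | zero => exact one_pos
  | succ n ih => exact Nat.mul_pos two_pos (Nat.mul_pos (hc n) ih)

lemma periods_pos (hc : ∀ n, 0 < c n) (n : ℕ) : 0 < periods c n :=
  Nat.mul_pos (hc n) (cells_pos hc n)

lemma cells_succ (c : ℕ → ℕ) (n : ℕ) : cells c (n + 1) = 2 * periods c n := rfl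

lemma two_pow_le_cells (hc : ∀ n, 0 < c n) (n : ℕ) : 2 ^ n ≤ cells c n := by
  induction n with
  | zero => exact le_rfl
  | succ n ih =>
    rw [cells, pow_succ']
    exact Nat.mul_le_mul_left 2 (ih.trans (Nat.le_mul_of_pos_left _ (hc n)))

lemma cells_dvd_periods (c : ℕ → ℕ) {n k : ℕ} (h : n ≤ k) : cells c n ∣ periods c k := by
  induction k, h using Nat.le_induction with
  | base => exact Dvd.intro_left _ rfl
  | succ k _ ih =>
    exact (ih.trans (Dvd.intro_left 2 (cells_succ c k).symm)).trans (Dvd.intro_left _ rfl)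

lemma tent_nonneg (c : ℕ → ℕ) (n : ℕ) (t : ℝ) : 0 ≤ tent c n t :=
  div_nonneg (le_min (Int.fract_nonneg _) (sub_nonneg.2 (Int.fract_lt_one _).le))
    (Nat.cast_nonneg _)

lemma tent_le (hc : ∀ n, 0 < c n) (n : ℕ) (t : ℝ) : tent c n t ≤ 1 / c n := by
  have h1 : (0:ℝ) < c n := by exact_mod_cast hc n
  have h2 : (c n : ℝ) ≤ periods c n := by
    exact_mod_cast Nat.le_mul_of_pos_right _ (cells_pos hc n)
  unfold tent
  gcongr
  exact (min_le_left _ _).trans (Int.fract_lt_one _).le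

lemma tent_eq_zero_of_int {n : ℕ} {t : ℝ} {j : ℤ} (h : periods c n * t = j) :
    tent c n t = 0 := by
  simp [tent, h]

lemma tent_eq_min (hc : ∀ n, 0 < c n) {n : ℕ} {t : ℝ} {j : ℤ} (h1 : j ≤ periods c n * t)
    (h2 : periods c n * t ≤ j + 1) :
    tent c n t = min (t - j / periods c n) ((j + 1) / periods c n - t) := by
  have hp : (0:ℝ) < periods c n := by exact_mod_cast periods_pos hc n
  rcases h2.lt_or_eq with h2 | h2
  · have hf : ⌊(periods c n : ℝ) * t⌋ = j := Int.floor_eq_iff.2 ⟨h1, h2⟩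
    rw [tent, Int.fract, hf, ← min_div_div_right hp.le]
    congr 1 <;> field_simp
    ring
  · rw [tent_eq_zero_of_int (j := j + 1) (by rw [h2]; push_cast; ring)]
    have ht : t = (j + 1) / periods c n := by field_simp; linarith
    rw [ht, sub_self, min_eq_right]
    rw [← sub_div]
    simp

lemma lt_floor_add_one_of_mul {m : ℕ} (hm : 0 < m) {y z : ℝ}
    (h : m * z < ⌊(m:ℝ) * y⌋ + 1) : z < ⌊y⌋ + 1 := by
  have hm' : (0:ℝ) < m := by exact_mod_cast hm
  have h1 : (m:ℝ) * y < ((m * (⌊y⌋ + 1) : ℤ) : ℝ) := by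
    push_cast
    exact mul_lt_mul_of_pos_left (Int.lt_floor_add_one y) hm'
  have h2 : ((⌊(m:ℝ) * y⌋ + 1 : ℤ) : ℝ) ≤ ((m * (⌊y⌋ + 1) : ℤ) : ℝ) := by
    exact_mod_cast Int.add_one_le_of_lt (Int.floor_lt.2 h1)
  push_cast at h2
  exact lt_of_mul_lt_mul_left (h.trans_le h2) hm'.le

lemma le_floor_add_one_of_mul {m : ℕ} (hm : 0 < m) {y z : ℝ}
    (h : m * z ≤ ⌊(m:ℝ) * y⌋ + 1) : z ≤ ⌊y⌋ + 1 := by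
  have hm' : (0:ℝ) < m := by exact_mod_cast hm
  refine le_of_forall_lt fun u hu => lt_floor_add_one_of_mul hm (h.trans_lt' ?_)
  exact mul_lt_mul_of_pos_left hu hm'

lemma fract_lt_half_iff {y z : ℝ} (hyz : y ≤ z) (h : 2 * z < ⌊2 * y⌋ + 1) :
    Int.fract y < 1 / 2 ↔ Int.fract z < 1 / 2 := by
  have hz : z < ⌊y⌋ + 1 := lt_floor_add_one_of_mul two_pos (by exact_mod_cast h)
  have hf : ⌊z⌋ = ⌊y⌋ := Int.floor_eq_iff.2 ⟨(Int.floor_le y).trans hyz, hz⟩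
  rw [Int.fract, Int.fract, hf]
  constructor
  · intro hy
    have h1 : ⌊2 * y⌋ < 2 * ⌊y⌋ + 1 := Int.floor_lt.2 (by push_cast; linarith)
    have h2 : ((⌊2 * y⌋ + 1 : ℤ) : ℝ) ≤ ((2 * ⌊y⌋ + 1 : ℤ) : ℝ) := by exact_mod_cast h1
    push_cast at h2
    linarith
  · intro hz
    linarith

lemma slopeCdf_congr (hc : ∀ n, 0 < c n) {n : ℕ} {s t : ℝ} (hst : s ≤ t)
    (h : cells c n * t < ⌊(cells c n : ℝ) * s⌋ + 1) : slopeCdf c n s = slopeCdf c n t := by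
  induction n with
  | zero => rfl
  | succ n ih =>
    have h' : 2 * (periods c n * t) < ⌊2 * ((periods c n : ℝ) * s)⌋ + 1 := by
      simpa [cells_succ, mul_assoc] using h
    have h1 : periods c n * t < ⌊(periods c n : ℝ) * s⌋ + 1 :=
      lt_floor_add_one_of_mul two_pos (by exact_mod_cast h')
    have h2 : cells c n * t < ⌊(cells c n : ℝ) * s⌋ + 1 :=
      lt_floor_add_one_of_mul (hc n) (by simpa [periods, mul_assoc] using h1)
    rw [slopeCdf, slopeCdf, ih h2]
    simp only [fract_lt_half_iff
      (mul_le_mul_of_nonneg_left hst (Nat.cast_nonneg (periods c n))) h']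

lemma tent_mul_bump_congr (hc : ∀ n, 0 < c n) {n : ℕ} {s t : ℝ} (hst : s ≤ t)
    (h : periods c n * t ≤ ⌊(periods c n : ℝ) * s⌋ + 1) (x : ℝ) :
    tent c n t * (bump (slopeCdf c n t)).eval x
      = tent c n t * (bump (slopeCdf c n s)).eval x := by
  rcases h.lt_or_eq with h | h
  · rw [slopeCdf_congr hc hst]
    exact lt_floor_add_one_of_mul (hc n) (by simpa [periods, mul_assoc] using h)
  · rw [tent_eq_zero_of_int (j := ⌊(periods c n : ℝ) * s⌋ + 1) (by rw [h]; push_cast; rfl)]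
    simp

/-- Up to the end of a cell, the `n`-th approximation is affine in time. -/
lemma approx_sub_approx (hc : ∀ n, 0 < c n) {n : ℕ} {s t : ℝ} (hst : s ≤ t)
    (h : cells c n * t ≤ ⌊(cells c n : ℝ) * s⌋ + 1) (x : ℝ) :
    approx c n t x - approx c n s x = (t - s) * (derivative (slopeCdf c n s)).eval x := by
  induction n with
  | zero => simp [approx, slopeCdf]
  | succ n ih =>
    have hp : (0:ℝ) < periods c n := by exact_mod_cast periods_pos hc n
    have h' : 2 * (periods c n * t) ≤ ⌊2 * ((periods c n : ℝ) * s)⌋ + 1 := by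
      simpa [cells_succ, mul_assoc] using h
    have h1 : periods c n * t ≤ ⌊(periods c n : ℝ) * s⌋ + 1 :=
      le_floor_add_one_of_mul two_pos (by exact_mod_cast h')
    have h2 : cells c n * t ≤ ⌊(cells c n : ℝ) * s⌋ + 1 :=
      le_floor_add_one_of_mul (hc n) (by simpa [periods, mul_assoc] using h1)
    have e : ∀ u, approx c (n + 1) u x
        = approx c n u x + tent c n u * (bump (slopeCdf c n u)).eval x := fun u => by
      simp [approx, Finset.sum_range_succ, add_assoc]
    have hs0 := Int.floor_le ((periods c n : ℝ) * s)
    have hs1 := (Int.lt_floor_add_one ((periods c n : ℝ) * s)).le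
    have ht0 := hs0.trans (mul_le_mul_of_nonneg_left hst hp.le)
    rw [e, e, tent_mul_bump_congr hc hst h1, eval_bump, tent_eq_min hc hs0 hs1,
      tent_eq_min hc ht0 h1, slopeCdf, Int.fract]
    have key := ih h2
    set j := ⌊(periods c n : ℝ) * s⌋
    split_ifs with hlt
    · have h3 : ⌊2 * ((periods c n : ℝ) * s)⌋ < 2 * j + 1 :=
        Int.floor_lt.2 (by push_cast; linarith)
      have h4 : ((⌊2 * ((periods c n : ℝ) * s)⌋ + 1 : ℤ) : ℝ) ≤ ((2 * j + 1 : ℤ) : ℝ) := by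
        exact_mod_cast h3
      push_cast at h4
      rw [min_eq_left (by field_simp; linarith), min_eq_left (by field_simp; linarith)]
      simp only [pow_two, derivative_mul, eval_add, eval_mul]
      linear_combination key
    · have hts := mul_le_mul_of_nonneg_left hst hp.le
      rw [min_eq_right (by field_simp; linarith), min_eq_right (by field_simp; linarith)]
      simp only [pow_two, derivative_mul, eval_add, eval_mul, derivative_sub, eval_sub,
        derivative_ofNat, eval_ofNat, eval_zero]
      linear_combination key

lemma approx_mono (hc : ∀ n, 0 < c n) (n : ℕ) {x : ℝ} (hx : x ∈ Icc (0:ℝ) 1) :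
    Monotone fun t => approx c n t x := by
  have hp : (0:ℝ) < cells c n := by exact_mod_cast cells_pos hc n
  have step : ∀ s t, s ≤ t → cells c n * t ≤ ⌊(cells c n : ℝ) * s⌋ + 1 →
      approx c n s x ≤ approx c n t x := fun s t hst h => by
    have := approx_sub_approx hc hst h x
    have h' := mul_nonneg (sub_nonneg.2 hst)
      ((IsCdf.of_mem_cdfSet (slopeCdf_mem c n s)).derivative_nonneg x hx)
    linarith
  have main : ∀ (k : ℕ) (s t : ℝ), s ≤ t → cells c n * t ≤ ⌊(cells c n : ℝ) * s⌋ + 1 + k →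
      approx c n s x ≤ approx c n t x := fun k => by
    induction k with
    | zero => exact fun s t hst h => step s t hst (by simpa using h)
    | succ k ih =>
      intro s t hst h
      rcases le_total (cells c n * t) (⌊(cells c n : ℝ) * s⌋ + 1) with h' | h'
      · exact step s t hst h'
      · set r : ℝ := (⌊(cells c n : ℝ) * s⌋ + 1) / cells c n with hr
        have hr' : cells c n * r = ((⌊(cells c n : ℝ) * s⌋ + 1 : ℤ) : ℝ) := by
          rw [hr]; push_cast; field_simp
        refine (step s r ?_ ?_).trans (ih r t ?_ ?_)
        · rw [hr, le_div_iff₀ hp, mul_comm]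
          exact (Int.lt_floor_add_one _).le
        · rw [hr']; push_cast; rfl
        · rw [hr, div_le_iff₀ hp, mul_comm t]
          exact h'
        · rw [hr', Int.floor_intCast]
          push_cast at h ⊢
          linarith
  intro s t hst
  obtain ⟨k, hk⟩ := exists_nat_ge (cells c n * t - (⌊(cells c n : ℝ) * s⌋ + 1))
  exact main k s t hst (by linarith)

lemma abs_iterate_derivative_term_le (hc : ∀ n, 0 < c n) {w : ℕ → ℝ}
    (hb : ∀ n, ∀ P ∈ cdfSet n, ∀ m, ∀ x ∈ Ioo (-1:ℝ) 2,
      |(derivative^[m] (bump P)).eval x| ≤ c n * ((1 / 2 / 2 ^ n) * w m))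
    (t : ℝ) (n m : ℕ) (x : ℝ) (hx : x ∈ Ioo (-1:ℝ) 2) :
    |(derivative^[m] (C (tent c n t) * bump (slopeCdf c n t))).eval x|
      ≤ 1 / 2 / 2 ^ n * w m := by
  have hc' : (0:ℝ) < c n := by exact_mod_cast hc n
  rw [iterate_derivative_C_mul, eval_mul, eval_C, abs_mul, abs_of_nonneg (tent_nonneg c n t)]
  calc _ ≤ 1 / c n * (c n * ((1 / 2 / 2 ^ n) * w m)) :=
        mul_le_mul (tent_le hc n t) (hb n _ (slopeCdf_mem c n t) m x hx) (abs_nonneg _)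
          (by positivity)
    _ = _ := by field_simp

lemma integral_curve {t : ℝ} {w : ℕ → ℝ}
    (hq : ∀ n m, ∀ x ∈ Ioo (-1:ℝ) 2,
      |(derivative^[m] (C (tent c n t) * bump (slopeCdf c n t))).eval x| ≤ 1 / 2 / 2 ^ n * w m) :
    ∫ x, curve c t x ∂mu01 = t := by
  have hint : ∀ n, Integrable
      (fun x => (C (tent c n t) * bump (slopeCdf c n t)).eval x) mu01 :=
    fun n => (Polynomial.continuous _).continuousOn.integrable_mu01
  have hsum := hasSum_integral_of_dominated_convergence (μ := mu01)
    (F := fun n x => (C (tent c n t) * bump (slopeCdf c n t)).eval x)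
    (f := fun x => ∑' n, (C (tent c n t) * bump (slopeCdf c n t)).eval x)
    (fun n _ => 1 / 2 / 2 ^ n * w 0) (fun n => (hint n).aestronglyMeasurable)
    (fun n => (ae_restrict_mem measurableSet_Icc).mono
      fun x hx => hq n 0 x (Icc_zero_one_subset_Ioo hx))
    (.of_forall fun _ => (hasSum_half_geometric_mul (w 0)).summable)
    (integrable_const _)
    ((ae_restrict_mem measurableSet_Icc).mono
      fun x hx => (summable_iterate_derivative hq 0 (Icc_zero_one_subset_Ioo hx)).hasSum)
  have hzero : ∀ n, ∫ x, (C (tent c n t) * bump (slopeCdf c n t)).eval x ∂mu01 = 0 :=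
    fun n => by
      simp only [eval_mul, eval_C]
      rw [integral_const_mul, integral_bump (.of_mem_cdfSet (slopeCdf_mem c n t)), mul_zero]
  simp only [hzero] at hsum
  have hcont : ContinuousOn (curve c t) (Icc 0 1) :=
    (contDiffOn_const_add_tsum_eval hq t).continuousOn
  have hint' : Integrable (fun x => curve c t x - t) mu01 :=
    hcont.integrable_mu01.sub (integrable_const t)
  have hI : ∫ x, (curve c t x - t) ∂mu01 = 0 := by
    simpa [curve] using hsum.unique hasSum_zero
  rw [integral_sub hcont.integrable_mu01 (integrable_const t)] at hI
  simpa [sub_eq_zero] using hI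

lemma tendsto_approx {t x : ℝ}
    (h : Summable fun n => (C (tent c n t) * bump (slopeCdf c n t)).eval x) :
    Filter.Tendsto (fun n => approx c n t x) Filter.atTop (nhds (curve c t x)) := by
  simpa [approx, curve] using h.hasSum.tendsto_sum_nat.const_add t

lemma curve_eq_approx {n : ℕ} {t : ℝ} {j : ℤ} (h : cells c n * t = j) (x : ℝ) :
    curve c t x = approx c n t x := by
  rw [curve, approx, tsum_eq_sum (s := Finset.range n)]
  · simp
  · intro k hk
    obtain ⟨d, hd⟩ := cells_dvd_periods c (not_lt.1 (mt Finset.mem_range.2 hk))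
    rw [tent_eq_zero_of_int (j := d * j) (by rw [hd]; push_cast; rw [← h]; ring)]
    simp

/-- The second difference of the curve over a period of the `n`-th oscillation. -/
lemma curve_second_difference (hc : ∀ n, 0 < c n) (n k : ℕ) {a h : ℝ}
    (ha : periods c n * a = k) (hh : periods c n * (2 * h) = 1) (x : ℝ) :
    curve c a x - 2 * curve c (a + h) x + curve c (a + 2 * h) x
      = -(2 * h) * (bump (slopeCdf c n a)).eval x := by
  have hp : (0:ℝ) < periods c n := by exact_mod_cast periods_pos hc n
  have hh0 : 0 < h := by
    by_contra! hneg
    nlinarith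
  have hcast : (cells c (n + 1) : ℝ) = 2 * periods c n := by rw [cells_succ]; push_cast; rfl
  rw [curve_eq_approx (n := n + 1) (j := 2 * k)
      (by push_cast; rw [hcast]; linear_combination 2 * ha),
    curve_eq_approx (n := n + 1) (j := 2 * k + 1)
      (by push_cast; rw [hcast]; linear_combination 2 * ha + hh),
    curve_eq_approx (n := n + 1) (j := 2 * k + 2)
      (by push_cast; rw [hcast]; linear_combination 2 * ha + 2 * hh)]
  have e : ∀ u, approx c (n + 1) u x
      = approx c n u x + tent c n u * (bump (slopeCdf c n u)).eval x := fun u => by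
    simp [approx, Finset.sum_range_succ, add_assoc]
  have hfl : ⌊(periods c n : ℝ) * a⌋ = k := by rw [ha]; simp
  have hmid : periods c n * (a + h) = k + 1 / 2 := by linear_combination ha + hh / 2
  have hend : periods c n * (a + 2 * h) = k + 1 := by linear_combination ha + hh
  have hcell : ∀ u : ℝ, periods c n * u ≤ k + 1 →
      cells c n * u ≤ ⌊(cells c n : ℝ) * a⌋ + 1 :=
    fun u hu => le_floor_add_one_of_mul (hc n) (by
      have hu' : periods c n * u ≤ ⌊(periods c n : ℝ) * a⌋ + 1 := by
        rwa [hfl]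
      simpa [periods, mul_assoc] using hu')
  have d1 := approx_sub_approx hc (n := n) (by linarith : a ≤ a + h)
    (hcell _ (by rw [hmid]; linarith)) x
  have d2 := approx_sub_approx hc (n := n) (by linarith : a ≤ a + 2 * h)
    (hcell _ hend.le) x
  have t0 : tent c n a = 0 := tent_eq_zero_of_int (j := k) (by rw [ha]; simp)
  have t2 : tent c n (a + 2 * h) = 0 := tent_eq_zero_of_int (j := k + 1) (by rw [hend]; simp)
  have t1 : tent c n (a + h) = h := by
    rw [tent_eq_min hc (j := k) (by rw [hmid]; simp) (by rw [hmid]; push_cast; linarith)]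
    have h1 : a = k / periods c n := by field_simp; linarith
    have h2 : a + 2 * h = (k + 1) / periods c n := by field_simp; linarith
    push_cast
    rw [← h1, ← h2, min_eq_left (by linarith)]
    ring
  rw [e, e, e, tent_mul_bump_congr hc (by linarith : a ≤ a + h)
    (by rw [hmid, hfl]; push_cast; linarith), t0, t1, t2]
  linear_combination d2 - 2 * d1

end Construction

/-- A derivative controls the symmetric second differences over intervals around the point. -/
lemma HasDerivAtWithin01.norm_second_difference_le {E : Type*} [NormedAddCommGroup E]
    [NormedSpace ℝ E] {F : ℝ → E} {D : E} {t₀ : ℝ} (hF : HasDerivAtWithin01 F D t₀) {ε : ℝ}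
    (hε : 0 < ε) :
    ∃ δ > (0:ℝ), ∀ a h : ℝ, 2 * h < δ → 0 ≤ a → a ≤ t₀ → t₀ ≤ a + 2 * h → a + 2 * h ≤ 1 →
      ‖F a - (2:ℝ) • F (a + h) + F (a + 2 * h)‖ ≤ 8 * ε * h := by
  obtain ⟨δ, hδ, H⟩ := hF ε hε
  refine ⟨δ, hδ, fun a h hhδ ha0 hat hta ha1 => ?_⟩
  have key : ∀ u ∈ Icc a (a + 2 * h), ‖F u - F t₀ - (u - t₀) • D‖ ≤ ε * (2 * h) := by
    intro u hu
    have habs : |u - t₀| ≤ 2 * h := abs_le.2 ⟨by linarith [hu.1], by linarith [hu.2]⟩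
    have := H (u - t₀) ⟨by linarith [hu.1], by linarith [hu.2]⟩ (by linarith)
    rw [add_sub_cancel] at this
    exact this.trans (mul_le_mul_of_nonneg_left habs hε.le)
  have k0 := key a ⟨le_rfl, by linarith⟩
  have k1 := key (a + h) ⟨by linarith, by linarith⟩
  have k2 := key (a + 2 * h) ⟨by linarith, le_rfl⟩
  have e : F a - (2:ℝ) • F (a + h) + F (a + 2 * h)
      = (F a - F t₀ - (a - t₀) • D) - (2:ℝ) • (F (a + h) - F t₀ - (a + h - t₀) • D)
        + (F (a + 2 * h) - F t₀ - (a + 2 * h - t₀) • D) := by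
    module
  rw [e]
  refine (norm_add_le _ _).trans ?_
  have h1 := norm_sub_le (F a - F t₀ - (a - t₀) • D)
    ((2:ℝ) • (F (a + h) - F t₀ - (a + h - t₀) • D))
  rw [norm_smul, Real.norm_ofNat] at h1
  linarith

lemma exists_nat_period_mem {N : ℕ} (hN : 0 < N) {t : ℝ} (ht : t ∈ Icc (0:ℝ) 1) :
    ∃ k : ℕ, k + 1 ≤ N ∧ (k:ℝ) ≤ N * t ∧ N * t ≤ k + 1 := by
  have hN' : (0:ℝ) < N := by exact_mod_cast hN
  have h0 : 0 ≤ N * t := mul_nonneg hN'.le ht.1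
  rcases ht.2.lt_or_eq with h1 | rfl
  · refine ⟨⌊N * t⌋₊, ?_, Nat.floor_le h0, (Nat.lt_floor_add_one _).le⟩
    rw [Nat.add_one_le_iff, Nat.floor_lt h0]
    nlinarith
  · refine ⟨N - 1, by lia, ?_, ?_⟩
    · rw [Nat.cast_pred hN]
      linarith
    · rw [Nat.cast_pred hN]
      linarith

lemma norm_eq_integral_abs_of_ae_eq {f : Lp ℝ 1 mu01} {g : ℝ → ℝ} (h : f =ᵐ[mu01] g) :
    ‖f‖ = ∫ x, |g x| ∂mu01 := by
  rw [L1.norm_eq_integral_norm]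
  exact integral_congr_ae (h.mono fun x hx => by simp [hx])

/-- For every sequence `ω_m > 0` there is a nowhere differentiable isometric
embedding `F : [0,1] → L¹[0,1]` such that each `F_t` has a `C^∞` representative
on `[0,1]` with `|F_t⁽ᵐ⁾(x)| ≤ ω_m` for all `m ≥ 1`, `x ∈ [0,1]`. -/
theorem main_theorem (ω : ℕ → ℝ) (hω : ∀ m, 1 ≤ m → 0 < ω m) :
    ∃ F : ℝ → Lp ℝ 1 mu01,
      (∀ s ∈ Icc (0:ℝ) 1, ∀ t ∈ Icc (0:ℝ) 1, ‖F t - F s‖ = |t - s|) ∧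
      (∀ t₀ ∈ Icc (0:ℝ) 1, ¬ ∃ D : Lp ℝ 1 mu01, HasDerivAtWithin01 F D t₀) ∧
      (∀ t ∈ Icc (0:ℝ) 1, ∃ g : ℝ → ℝ,
        ContDiffOn ℝ (⊤ : ℕ∞) g (Icc (0:ℝ) 1) ∧ (F t : ℝ → ℝ) =ᵐ[mu01] g ∧
        ∀ m : ℕ, 1 ≤ m → ∀ x ∈ Icc (0:ℝ) 1,
          |iteratedDerivWithin m g (Icc (0:ℝ) 1) x| ≤ ω m) := by
  set w : ℕ → ℝ := fun m => if m = 0 then 1 else ω m with hw_def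
  have hw : ∀ m, 0 < w m := fun m => by
    by_cases h : m = 0
    · simp [hw_def, h]
    · simpa [hw_def, h] using hω m (Nat.one_le_iff_ne_zero.2 h)
  choose c hc hb using exists_bound_cdfSet hw
  have hq := abs_iterate_derivative_term_le hc hb
  have hsmooth : ∀ t, ContDiffOn ℝ (⊤ : ℕ∞) (curve c t) (Icc 0 1) :=
    fun t => contDiffOn_const_add_tsum_eval (hq t) t
  have hint : ∀ t, Integrable (curve c t) mu01 :=
    fun t => (hsmooth t).continuousOn.integrable_mu01
  refine ⟨fun t => (hint t).toL1 (curve c t), ?_, ?_, ?_⟩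
  · have hmono : ∀ s t, s ≤ t →
        ‖(hint t).toL1 (curve c t) - (hint s).toL1 (curve c s)‖ = t - s := by
      intro s t hst
      rw [← Integrable.toL1_sub, norm_eq_integral_abs_of_ae_eq (Integrable.coeFn_toL1 _)]
      have hpos : ∀ x ∈ Icc (0:ℝ) 1,
          |(curve c t - curve c s) x| = curve c t x - curve c s x := fun x hx => by
        refine abs_of_nonneg (sub_nonneg.2 (le_of_tendsto_of_tendsto' (tendsto_approx ?_)
          (tendsto_approx ?_) fun n => approx_mono hc n hx hst))
        · exact summable_iterate_derivative (hq s) 0 (Icc_zero_one_subset_Ioo hx)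
        · exact summable_iterate_derivative (hq t) 0 (Icc_zero_one_subset_Ioo hx)
      rw [setIntegral_congr_fun measurableSet_Icc hpos, integral_sub (hint t) (hint s),
        integral_curve (hq t), integral_curve (hq s)]
    intro s _ t _
    rcases le_total s t with h | h
    · rw [hmono s t h, abs_of_nonneg (sub_nonneg.2 h)]
    · rw [norm_sub_rev, hmono t s h, abs_sub_comm, abs_of_nonneg (sub_nonneg.2 h)]
  · rintro t₀ ht₀ ⟨D, hD⟩
    obtain ⟨δ, hδ, H⟩ := hD.norm_second_difference_le (ε := 1 / 20) (by norm_num)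
    obtain ⟨n, hn⟩ := pow_unbounded_of_one_lt (1 / δ) (one_lt_two (α := ℝ))
    obtain ⟨k, hkN, hk0, hk1⟩ := exists_nat_period_mem (periods_pos hc n) ht₀
    have hp : (0:ℝ) < periods c n := by exact_mod_cast periods_pos hc n
    have hkN' : (k:ℝ) + 1 ≤ periods c n := by exact_mod_cast hkN
    have hle : (2:ℝ) ^ n ≤ periods c n := by
      exact_mod_cast (two_pow_le_cells hc n).trans (Nat.le_mul_of_pos_left _ (hc n))
    set a : ℝ := k / periods c n with ha
    set h : ℝ := 1 / (2 * periods c n) with hh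
    have ha' : periods c n * a = k := by rw [ha]; field_simp
    have hh' : periods c n * (2 * h) = 1 := by rw [hh]; field_simp
    have hpos : 0 < h := by positivity
    have hlt : 2 * h < δ := by
      have : 1 < periods c n * δ := (div_lt_iff₀ hδ).1 (hn.trans_le hle)
      exact lt_of_mul_lt_mul_left (hh'.trans_lt this) hp.le
    have hnorm := H a h hlt (by positivity)
      (le_of_mul_le_mul_left (by rw [ha']; exact hk0) hp)
      (le_of_mul_le_mul_left (by rw [mul_add, ha', hh']; exact hk1) hp)
      (le_of_mul_le_mul_left (by rw [mul_add, ha', hh', mul_one]; exact hkN') hp)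
    have hae : (((hint a).toL1 (curve c a) - (2:ℝ) • (hint (a + h)).toL1 (curve c (a + h))
        + (hint (a + 2 * h)).toL1 (curve c (a + 2 * h)) : Lp ℝ 1 mu01) : ℝ → ℝ)
        =ᵐ[mu01] fun x => -(2 * h) * (bump (slopeCdf c n a)).eval x := by
      rw [← Integrable.toL1_smul, ← Integrable.toL1_sub, ← Integrable.toL1_add]
      refine (Integrable.coeFn_toL1 _).trans (.of_forall fun x => ?_)
      exact curve_second_difference hc n k ha' hh' x
    rw [norm_eq_integral_abs_of_ae_eq hae] at hnorm
    simp only [abs_mul, abs_neg] at hnorm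
    rw [integral_const_mul, abs_of_pos two_pos, abs_of_pos hpos] at hnorm
    have := integral_abs_bump_ge (.of_mem_cdfSet (slopeCdf_mem c n a))
    nlinarith
  · refine fun t _ => ⟨curve c t, hsmooth t, Integrable.coeFn_toL1 _, fun m hm x hx => ?_⟩
    have hm' : m ≠ 0 := Nat.one_le_iff_ne_zero.1 hm
    have := abs_iteratedDerivWithin_const_add_tsum_eval_le (hq t) t hm' hx
    rwa [show w m = ω m from if_neg hm'] at this
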